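/- Let α be irrational with |α − a/q| < 1/q², (a,q) = 1, q ≥ 1. Let M, S, J, x be positive reals with x > M³S²J, and let μ, σ, ζ be integers ≥ 2. Define G = Σ_{m ∼ M} τ_μ(m) Σ_{s ∼ S} τ_σ(s) Σ_{j ∼ J} τ_ζ(j) min{ x/(m³s²j), 1/‖α m³ s² j‖ }. Then for any ε > 0, G ≪ x^ε ( MSJ + x/(M^{9/4} S^{3/4}) + x/(M² S^{3/4} q^{1/4}) + x^{3/4} q^{1/4}/(M² S^{3/4}) ). -/

import Mathlib

noncomputable section

/-- `e y = exp(2πiy)`. -/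
def e (y : ℝ) : ℂ := Complex.exp (2 * Real.pi * Complex.I * y)

/-- Distance from `y` to the nearest integer. -/
def nint (y : ℝ) : ℝ := |y - round y|

/-- The set of naturals `n` with `X/2 ≤ n < X` (written `n ∼ X`). -/
def dyad (X : ℝ) : Finset ℕ := Finset.Ico ⌈X / 2⌉₊ ⌈X⌉₊

/-- `d` is a well-separable number of level `D`. -/
def WellSeparable (D : ℝ) (d : ℕ) : Prop :=
  ∀ H S : ℝ, 1 ≤ H → 1 ≤ S → H * S = D →
    ∃ h s : ℕ, (h : ℝ) ≤ H ∧ (s : ℝ) ≤ S ∧ d = h * s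

/-- `K = x^θ (log x)²`. -/
def Kf (θ x : ℝ) : ℝ := x ^ θ * (Real.log x) ^ 2

/-- `Δ = x^ρ`. -/
def Δf (ρ x : ℝ) : ℝ := x ^ ρ

/-- `D = x^{1/2} / (Δ K⁴)`. -/
def Df (θ ρ x : ℝ) : ℝ := x ^ ((1 : ℝ) / 2) / (Δf ρ x * (Kf θ x) ^ 4)

/-- The exponential sum `W(x)`. -/
def Wsum (α β : ℝ) (b : ℤ) (D K x : ℝ) (lam : ℕ → ℂ) (c : ℤ → ℂ) : ℂ :=
  ∑ d ∈ Finset.Icc 1 ⌊D⌋₊, lam d *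
    ∑ k ∈ (Finset.Icc (-(⌊K⌋₊ : ℤ)) (⌊K⌋₊ : ℤ)).filter (fun k => k ≠ 0), c k *
      ∑ n ∈ dyad x,
        if (n : ℤ) % (d : ℤ) = b % (d : ℤ) then
          (ArithmeticFunction.vonMangoldt n : ℂ) *
            e ((α * (n : ℝ) ^ 2 + β) * (k : ℝ))
        else 0

/-- `τ_k(n)`: the number of ordered representations of `n` as a product of `k`
positive integers. -/
def tauk (k n : ℕ) : ℕ :=
  ((Fintype.piFinset fun _ : Fin k => Finset.Icc 1 n).filter
    (fun t => ∏ i, t i = n)).card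

/-- The sum `G` of Lemma 7. -/
def Gsum (α x M S J : ℝ) (μ σ ζ : ℕ) : ℝ :=
  ∑ m ∈ dyad M, (tauk μ m : ℝ) *
    ∑ s ∈ dyad S, (tauk σ s : ℝ) *
      ∑ j ∈ dyad J, (tauk ζ j : ℝ) *
        min (x / ((m : ℝ) ^ 3 * (s : ℝ) ^ 2 * (j : ℝ)))
          (1 / nint (α * ((m : ℝ) ^ 3 * (s : ℝ) ^ 2 * (j : ℝ))))



lemma aux_card_divisors (ε : ℝ) (hε : 0 < ε) :
    ∃ C : ℝ, 1 ≤ C ∧ ∀ n : ℕ, 1 ≤ n → (n.divisors.card : ℝ) ≤ C * (n : ℝ) ^ ε := by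
  have hl2 : 0 < Real.log 2 := Real.log_pos (by norm_num)
  set B : ℝ := 1 + 1 / (ε * Real.log 2) with hB
  have hB1 : 1 ≤ B := by
    rw [hB]; have : 0 < 1 / (ε * Real.log 2) := by positivity
    linarith
  set P : ℕ := ⌈(2 : ℝ) ^ (1 / ε)⌉₊ with hP
  refine ⟨B ^ P, one_le_pow₀ hB1, ?_⟩
  intro n hn
  have hn0 : n ≠ 0 := by omega
  rw [Nat.card_divisors hn0]
  have h1 : ∀ p ∈ n.primeFactors, ((n.factorization p + 1 : ℕ) : ℝ) ≤
      (if p < P then B else 1) * (((p : ℝ) ^ (n.factorization p)) ^ ε) := by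
    intro p hp
    have hpp : p.Prime := Nat.prime_of_mem_primeFactors hp
    set k := n.factorization p with hk
    have hp2 : (2 : ℝ) ≤ p := by exact_mod_cast hpp.two_le
    have hpow : ((p : ℝ) ^ k) ^ ε = ((p : ℝ) ^ ε) ^ k := by
      rw [← Real.rpow_natCast, ← Real.rpow_natCast, ← Real.rpow_mul (by positivity),
        ← Real.rpow_mul (by positivity), mul_comm]
    rw [hpow]
    split_ifs with h
    · have h2 : ((2 : ℝ) ^ ε) ^ k ≤ ((p : ℝ) ^ ε) ^ k := by
        gcongr
      have h3 : 1 + ε * Real.log 2 * k ≤ ((2 : ℝ) ^ ε) ^ k := by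
        rw [← Real.rpow_natCast, ← Real.rpow_mul (by positivity),
          Real.rpow_def_of_pos (by norm_num)]
        have := Real.add_one_le_exp (Real.log 2 * (ε * (k : ℝ)))
        nlinarith
      have h4 : (k : ℝ) + 1 ≤ B * (1 + ε * Real.log 2 * k) := by
        have : B * (1 + ε * Real.log 2 * k) = 1 + ε * Real.log 2 * k + 1 / (ε * Real.log 2) + k := by
          rw [hB]; field_simp; ring
        rw [this]
        have : 0 ≤ ε * Real.log 2 * k := by positivity
        have : 0 < 1 / (ε * Real.log 2) := by positivity
        linarith
      push_cast
      calc (k : ℝ) + 1 ≤ B * (1 + ε * Real.log 2 * k) := h4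
        _ ≤ B * ((p : ℝ) ^ ε) ^ k := by
          apply mul_le_mul_of_nonneg_left (h3.trans h2) (by linarith)
    · have hpP : (2 : ℝ) ^ (1 / ε) ≤ p := by
        have : P ≤ p := by omega
        exact (Nat.le_ceil _).trans (by exact_mod_cast this)
      have h5 : (2 : ℝ) ≤ (p : ℝ) ^ ε := by
        calc (2 : ℝ) = ((2 : ℝ) ^ (1 / ε)) ^ ε := by
              rw [← Real.rpow_mul (by norm_num)]; field_simp; simp
          _ ≤ _ := by gcongr
      have h6 : (2 : ℝ) ^ k ≤ ((p : ℝ) ^ ε) ^ k := by gcongr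
      have h7 : ((k + 1 : ℕ) : ℝ) ≤ (2 : ℝ) ^ k := by
        exact_mod_cast Nat.lt_two_pow_self
      linarith
  have h2 : (n : ℝ) ^ ε = ∏ p ∈ n.primeFactors, (((p : ℝ) ^ (n.factorization p)) ^ ε) := by
    rw [Real.finsetProd_rpow _ _ (fun i _ => by positivity)]
    congr 1
    have := Nat.prod_factorization_pow_eq_self hn0
    conv_lhs => rw [← this]
    rw [Finsupp.prod]
    push_cast
    rfl
  push_cast at h1 ⊢
  calc ∏ p ∈ n.primeFactors, ((n.factorization p : ℝ) + 1)
      ≤ ∏ p ∈ n.primeFactors, ((if p < P then B else 1) * (((p : ℝ) ^ (n.factorization p)) ^ ε)) :=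
        Finset.prod_le_prod (fun i _ => by positivity) h1
    _ = (∏ p ∈ n.primeFactors, (if p < P then B else 1)) * (n : ℝ) ^ ε := by
        rw [Finset.prod_mul_distrib, h2]
    _ ≤ B ^ P * (n : ℝ) ^ ε := by
        apply mul_le_mul_of_nonneg_right _ (by positivity)
        rw [← Finset.prod_filter, Finset.prod_const]
        apply pow_le_pow_right₀ hB1
        calc _ ≤ (Finset.range P).card := Finset.card_le_card (by
              intro p hp; simp at hp ⊢; exact hp.2)
          _ = P := by simp

lemma aux_tauk_le (k n : ℕ) (hn : 1 ≤ n) : tauk k n ≤ (n.divisors.card) ^ k := by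
  unfold tauk
  calc _ ≤ (Fintype.piFinset fun _ : Fin k => n.divisors).card := by
        apply Finset.card_le_card
        intro t ht
        simp only [Finset.mem_filter, Fintype.mem_piFinset] at ht ⊢
        intro i
        rw [Nat.mem_divisors]
        refine ⟨?_, by omega⟩
        rw [← ht.2]
        exact Finset.dvd_prod_of_mem _ (Finset.mem_univ i)
    _ = _ := by simp

lemma aux_div_pow (k : ℕ) (ε : ℝ) (hε : 0 < ε) :
    ∃ C : ℝ, 1 ≤ C ∧ ∀ n : ℕ, 1 ≤ n → (n.divisors.card : ℝ) ^ k ≤ C * (n : ℝ) ^ ε := by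
  obtain ⟨C, hC, h⟩ := aux_card_divisors (ε / (k + 1)) (by positivity)
  refine ⟨C ^ k, one_le_pow₀ hC, ?_⟩
  intro n hn
  have hn1 : (1 : ℝ) ≤ n := by exact_mod_cast hn
  calc (n.divisors.card : ℝ) ^ k ≤ (C * (n : ℝ) ^ (ε / (k + 1))) ^ k := by
        gcongr; exact h n hn
    _ = C ^ k * ((n : ℝ) ^ (ε / (k + 1) * k)) := by
        rw [mul_pow, Real.rpow_mul (by positivity), Real.rpow_natCast]
    _ ≤ C ^ k * (n : ℝ) ^ ε := by
        apply mul_le_mul_of_nonneg_left _ (by positivity)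
        apply Real.rpow_le_rpow_of_exponent_le hn1
        rw [div_mul_eq_mul_div, div_le_iff₀ (by positivity)]
        nlinarith

lemma aux_tauk_bound (k : ℕ) (ε : ℝ) (hε : 0 < ε) :
    ∃ C : ℝ, 1 ≤ C ∧ ∀ n : ℕ, 1 ≤ n → (tauk k n : ℝ) ≤ C * (n : ℝ) ^ ε := by
  obtain ⟨C, hC, h⟩ := aux_div_pow k ε hε
  refine ⟨C, hC, fun n hn => le_trans ?_ (h n hn)⟩
  exact_mod_cast aux_tauk_le k n hn


lemma aux_e_add (a b : ℝ) : e (a + b) = e a * e b := by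
  unfold e; rw [← Complex.exp_add]; congr 1; push_cast; ring

lemma aux_e_norm (a : ℝ) : ‖e a‖ = 1 := by
  unfold e
  have : (2 * Real.pi * Complex.I * a : ℂ) = ((2 * Real.pi * a : ℝ) : ℂ) * Complex.I := by
    push_cast; ring
  rw [this, Complex.norm_exp_ofReal_mul_I]

lemma aux_e_conj (a : ℝ) : (starRingEnd ℂ) (e a) = e (-a) := by
  unfold e
  rw [← Complex.exp_conj]
  congr 1
  have : (starRingEnd ℂ) 2 = 2 := Complex.conj_ofNat 2
  simp [this]

lemma aux_e_zero : e 0 = 1 := by simp [e]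

lemma aux_e_int (n : ℤ) : e n = 1 := by
  unfold e
  have := Complex.exp_int_mul_two_pi_mul_I n
  rw [← this]; congr 1; push_cast; ring

lemma aux_e_nat_mul (a : ℝ) (n : ℕ) : e (n * a) = e a ^ n := by
  unfold e; rw [← Complex.exp_nat_mul]; congr 1; push_cast; ring

lemma aux_nint_le (y : ℝ) : nint y ≤ 1 / 2 := abs_sub_round y
lemma aux_nint_nonneg (y : ℝ) : 0 ≤ nint y := abs_nonneg _

/-- `‖e(y) - 1‖ = 2 |sin (π y)|`. -/
lemma aux_norm_e_sub_one (y : ℝ) : ‖e y - 1‖ = 2 * |Real.sin (Real.pi * y)| := by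
  unfold e
  have : (2 * Real.pi * Complex.I * y : ℂ) = Complex.I * ((2 * Real.pi * y : ℝ) : ℂ) := by
    push_cast; ring
  rw [this, Complex.norm_exp_I_mul_ofReal_sub_one]
  rw [Real.norm_eq_abs, abs_mul, abs_of_pos (by norm_num : (0:ℝ) < 2)]
  congr 3; ring

lemma aux_e_nint (y : ℝ) : e y = e (y - round y) := by
  have : y = (y - round y) + (round y : ℝ) := by ring
  conv_lhs => rw [this]
  rw [aux_e_add, aux_e_int, mul_one]

lemma aux_e_sub_one_ge (y : ℝ) : 4 * nint y ≤ ‖e y - 1‖ := by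
  rw [aux_e_nint, aux_norm_e_sub_one]
  have h := aux_nint_le y
  unfold nint at *
  set t := y - round y
  have h1 : 2 / Real.pi * |Real.pi * t| ≤ |Real.sin (Real.pi * t)| := by
    apply Real.mul_abs_le_abs_sin
    rw [abs_mul, abs_of_pos Real.pi_pos]
    nlinarith [Real.pi_pos]
  rw [abs_mul, abs_of_pos Real.pi_pos] at h1
  have : 2 / Real.pi * (Real.pi * |t|) = 2 * |t| := by field_simp
  linarith

/-- Geometric sum. -/
lemma aux_geom (γ δ : ℝ) (n : ℕ) (h : nint γ ≠ 0) :
    ‖∑ m ∈ Finset.range n, e (γ * m + δ)‖ ≤ 1 / nint γ := by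
  have hpos : 0 < nint γ := lt_of_le_of_ne (aux_nint_nonneg γ) (Ne.symm h)
  have hge := aux_e_sub_one_ge γ
  have hne : e γ ≠ 1 := by
    intro h1; rw [h1] at hge; simp at hge; linarith
  have : ∑ m ∈ Finset.range n, e (γ * m + δ) = e δ * ∑ m ∈ Finset.range n, e γ ^ m := by
    rw [Finset.mul_sum]
    refine Finset.sum_congr rfl fun m _ => ?_
    rw [aux_e_add, mul_comm γ, aux_e_nat_mul, mul_comm]
  rw [this, norm_mul, aux_e_norm, one_mul, geom_sum_eq hne, norm_div]
  have hnum : ‖e γ ^ n - 1‖ ≤ 2 := by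
    calc _ ≤ ‖e γ ^ n‖ + ‖(1 : ℂ)‖ := norm_sub_le _ _
      _ = 2 := by rw [norm_pow, aux_e_norm]; norm_num
  rw [div_le_div_iff₀ (by linarith) hpos]
  nlinarith

lemma aux_triv (f : ℕ → ℝ) (n : ℕ) : ‖∑ m ∈ Finset.range n, e (f m)‖ ≤ n := by
  refine (norm_sum_le _ _).trans ?_
  simp [aux_e_norm]

/-- Weyl differencing, exact form. -/
lemma aux_diff_eq (L : ℕ) (z : ℕ → ℂ) :
    ‖∑ m ∈ Finset.range L, z m‖ ^ 2 + ∑ m ∈ Finset.range L, ‖z m‖ ^ 2 = 2 * ∑ u ∈ Finset.range L,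
    (∑ m ∈ Finset.range (L - u), z (m + u) * (starRingEnd ℂ) (z m)).re := by
  set D : ℕ → ℝ := fun L => ∑ u ∈ Finset.range L,
    (∑ m ∈ Finset.range (L - u), z (m + u) * (starRingEnd ℂ) (z m)).re with hD
  change ‖∑ m ∈ Finset.range L, z m‖ ^ 2 + ∑ m ∈ Finset.range L, ‖z m‖ ^ 2 = 2 * D L
  induction L with
  | zero => simp [hD]
  | succ L ih =>
    have hstep : D (L + 1) = D L + (z L * (starRingEnd ℂ) (∑ m ∈ Finset.range (L + 1), z m)).re := by
      simp only [hD]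
      rw [Finset.sum_range_succ]
      have h1 : ∀ u ∈ Finset.range L,
        (∑ m ∈ Finset.range (L + 1 - u), z (m + u) * (starRingEnd ℂ) (z m)).re
        = (∑ m ∈ Finset.range (L - u), z (m + u) * (starRingEnd ℂ) (z m)).re
          + (z L * (starRingEnd ℂ) (z (L - u))).re := by
        intro u hu
        rw [Finset.mem_range] at hu
        rw [show L + 1 - u = (L - u) + 1 by omega, Finset.sum_range_succ, Complex.add_re,
          show L - u + u = L by omega]
      rw [Finset.sum_congr rfl h1, Finset.sum_add_distrib]
      rw [add_assoc]
      congr 1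
      rw [map_sum, Finset.mul_sum, Complex.re_sum, Complex.re_sum]
      rw [← Finset.sum_range_reflect (fun i => (z L * (starRingEnd ℂ) (z i)).re) (L + 1)]
      rw [Finset.sum_range_succ]
      simp
    rw [hstep, Finset.sum_range_succ, Finset.sum_range_succ, mul_add, ← ih]
    set s := ∑ m ∈ Finset.range L, z m
    rw [← Complex.normSq_eq_norm_sq, ← Complex.normSq_eq_norm_sq, ← Complex.normSq_eq_norm_sq,
      Complex.normSq_apply, Complex.normSq_apply, Complex.normSq_apply]
    simp
    ring

/-- Weyl differencing. -/
lemma aux_diff (L : ℕ) (z : ℕ → ℂ) :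
    ‖∑ m ∈ Finset.range L, z m‖ ^ 2 ≤
      2 * ∑ u ∈ Finset.range L, ‖∑ m ∈ Finset.range (L - u), z (m + u) * (starRingEnd ℂ) (z m)‖ := by
  have h := aux_diff_eq L z
  have h0 : 0 ≤ ∑ m ∈ Finset.range L, ‖z m‖ ^ 2 := Finset.sum_nonneg fun _ _ => by positivity
  have h1 : ∑ u ∈ Finset.range L,
      (∑ m ∈ Finset.range (L - u), z (m + u) * (starRingEnd ℂ) (z m)).re ≤
      ∑ u ∈ Finset.range L, ‖∑ m ∈ Finset.range (L - u), z (m + u) * (starRingEnd ℂ) (z m)‖ :=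
    Finset.sum_le_sum fun u _ => Complex.re_le_norm _
  linarith

/-- Weyl's inequality for cubes. -/
lemma aux_weyl (β : ℝ) (A L : ℕ)
    (hirr : ∀ u v : ℕ, 1 ≤ u → 1 ≤ v → nint (β * (6 * u * v)) ≠ 0) :
    ‖∑ m ∈ Finset.range L, e (β * ((m + A : ℕ) : ℝ) ^ 3)‖ ^ 4 ≤
      8 * L * (2 * (L : ℝ) ^ 2 + ∑ u ∈ Finset.Ico 1 L, ∑ v ∈ Finset.Ico 1 L,
        min (L : ℝ) (1 / nint (β * (6 * u * v)))) := by
  set z : ℕ → ℂ := fun m => e (β * ((m + A : ℕ) : ℝ) ^ 3) with hz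
  set w : ℕ → ℕ → ℂ := fun u m => z (m + u) * (starRingEnd ℂ) (z m) with hw
  have hphase : ∀ u v m : ℕ, w u (m + v) * (starRingEnd ℂ) (w u m) =
      e ((β * (6 * u * v)) * m + β * (6 * A * u * v + 3 * u ^ 2 * v + 3 * u * v ^ 2)) := by
    intro u v m
    simp only [hw, hz, aux_e_conj, ← aux_e_add]
    congr 1
    push_cast
    ring
  have hd1 := aux_diff L z
  have hd2 : ∀ u ∈ Finset.range L, ‖∑ m ∈ Finset.range (L - u), w u m‖ ^ 2 ≤
      2 * ∑ v ∈ Finset.range L, ‖∑ m ∈ Finset.range (L - u - v), w u (m + v) * (starRingEnd ℂ) (w u m)‖ := by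
    intro u hu
    refine (aux_diff (L - u) (w u)).trans ?_
    gcongr
    omega
  set E : ℕ → ℕ → ℝ := fun u v =>
    ‖∑ m ∈ Finset.range (L - u - v), w u (m + v) * (starRingEnd ℂ) (w u m)‖ with hE
  have hEtriv : ∀ u v, E u v ≤ L := by
    intro u v
    simp only [hE, hphase]
    refine (aux_triv (fun m => (β * (6 * u * v)) * m + β * (6 * A * u * v + 3 * u ^ 2 * v + 3 * u * v ^ 2)) _).trans ?_
    exact_mod_cast (by omega)
  have hEmin : ∀ u v, 1 ≤ u → 1 ≤ v → E u v ≤ min (L : ℝ) (1 / nint (β * (6 * u * v))) := by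
    intro u v hu hv
    refine le_min (hEtriv u v) ?_
    simp only [hE, hphase]
    exact aux_geom _ _ _ (hirr u v hu hv)
  have hEsum : ∑ u ∈ Finset.range L, ∑ v ∈ Finset.range L, E u v ≤
      2 * (L : ℝ) ^ 2 + ∑ u ∈ Finset.Ico 1 L, ∑ v ∈ Finset.Ico 1 L,
        min (L : ℝ) (1 / nint (β * (6 * u * v))) := by
    rcases Nat.eq_zero_or_pos L with h0 | h0
    · subst h0; simp
    have split : ∀ f : ℕ → ℝ, ∑ u ∈ Finset.range L, f u = f 0 + ∑ u ∈ Finset.Ico 1 L, f u := by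
      intro f
      rw [Finset.range_eq_Ico, Finset.sum_eq_sum_Ico_succ_bot h0]
    rw [split]
    have a1 : ∑ v ∈ Finset.range L, E 0 v ≤ (L : ℝ) ^ 2 := by
      calc _ ≤ ∑ v ∈ Finset.range L, (L : ℝ) := Finset.sum_le_sum fun v _ => hEtriv 0 v
        _ = _ := by simp; ring
    have a2 : ∑ u ∈ Finset.Ico 1 L, ∑ v ∈ Finset.range L, E u v ≤ (L : ℝ) ^ 2 +
        ∑ u ∈ Finset.Ico 1 L, ∑ v ∈ Finset.Ico 1 L, min (L : ℝ) (1 / nint (β * (6 * u * v))) := by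
      simp_rw [split]
      rw [Finset.sum_add_distrib]
      refine add_le_add ?_ ?_
      · calc _ ≤ ∑ u ∈ Finset.Ico 1 L, (L : ℝ) := Finset.sum_le_sum fun v _ => hEtriv v 0
          _ ≤ ∑ u ∈ Finset.range L, (L : ℝ) := by
            apply Finset.sum_le_sum_of_subset_of_nonneg
            · intro i hi; simp at hi ⊢; exact hi.2
            · intros; positivity
          _ = _ := by simp; ring
      · apply Finset.sum_le_sum
        intro u hu
        apply Finset.sum_le_sum
        intro v hv
        exact hEmin u v (Finset.mem_Ico.1 hu).1 (Finset.mem_Ico.1 hv).1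
    linarith
  set X : ℕ → ℝ := fun u => ‖∑ m ∈ Finset.range (L - u), w u m‖ with hX
  calc ‖∑ m ∈ Finset.range L, z m‖ ^ 4 = (‖∑ m ∈ Finset.range L, z m‖ ^ 2) ^ 2 := by ring
    _ ≤ (2 * ∑ u ∈ Finset.range L, X u) ^ 2 := by gcongr
    _ = 4 * (∑ u ∈ Finset.range L, X u) ^ 2 := by ring
    _ ≤ 4 * (L * ∑ u ∈ Finset.range L, X u ^ 2) := by
        have := sq_sum_le_card_mul_sum_sq (s := Finset.range L) (f := X)
        simp only [Finset.card_range] at this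
        linarith
    _ ≤ 4 * (L * ∑ u ∈ Finset.range L, 2 * ∑ v ∈ Finset.range L, E u v) := by
        gcongr with u hu
        exact hd2 u hu
    _ = 8 * L * (∑ u ∈ Finset.range L, ∑ v ∈ Finset.range L, E u v) := by
        rw [← Finset.mul_sum]; ring
    _ ≤ _ := by gcongr


lemma aux_fejer_lower (θ : ℝ) (L : ℕ) (hL : 1 ≤ L) (h : nint θ ≤ 1 / (2 * L)) :
    (L : ℝ) / 4 ≤ (1 / L) * ‖∑ n ∈ Finset.range L, e (n * θ)‖ ^ 2 := by
  have hL0 : (0 : ℝ) < L := by exact_mod_cast hL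
  have key : (L : ℝ) / 2 ≤ ‖∑ n ∈ Finset.range L, e (n * θ)‖ := by
    set t := θ - round θ with ht
    have h1 : ∀ n : ℕ, e (n * θ) = e t ^ n := by
      intro n
      rw [aux_e_nat_mul, aux_e_nint θ]
    simp_rw [h1]
    have hn : nint θ = |t| := rfl
    rw [hn] at h
    by_cases ht0 : t = 0
    · rw [ht0, aux_e_zero]; simp
    have htpos : 0 < |t| := abs_pos.2 ht0
    have h2 : (∑ n ∈ Finset.range L, e t ^ n) * (e t - 1) = e t ^ L - 1 := geom_sum_mul _ _
    have h3 : ‖∑ n ∈ Finset.range L, e t ^ n‖ * ‖e t - 1‖ = ‖e (L * t) - 1‖ := by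
      rw [← norm_mul, h2, aux_e_nat_mul]
    have h4 : ‖e t - 1‖ ≤ 8 * |t| := by
      rw [aux_norm_e_sub_one]
      have := Real.abs_sin_le_abs (x := Real.pi * t)
      rw [abs_mul, abs_of_pos Real.pi_pos] at this
      nlinarith [Real.pi_le_four]
    have h5 : 4 * (L * |t|) ≤ ‖e (L * t) - 1‖ := by
      rw [aux_norm_e_sub_one]
      have hle : L * |t| ≤ 1 / 2 := by
        have := mul_le_mul_of_nonneg_left h hL0.le
        have h' : (L : ℝ) * (1 / (2 * L)) = 1 / 2 := by field_simp
        linarith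
      have h1 : 2 / Real.pi * |Real.pi * (L * t)| ≤ |Real.sin (Real.pi * (L * t))| := by
        apply Real.mul_abs_le_abs_sin
        rw [abs_mul, abs_of_pos Real.pi_pos, abs_mul, abs_of_pos hL0]
        nlinarith [Real.pi_pos]
      rw [abs_mul, abs_of_pos Real.pi_pos, abs_mul, abs_of_pos hL0] at h1
      have : 2 / Real.pi * (Real.pi * (L * |t|)) = 2 * (L * |t|) := by field_simp
      linarith
    have h6 : 4 * (L * |t|) ≤ ‖∑ n ∈ Finset.range L, e t ^ n‖ * (8 * |t|) := by
      rw [← h3] at h5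
      exact h5.trans (mul_le_mul_of_nonneg_left h4 (norm_nonneg _))
    by_contra hc
    push Not at hc
    nlinarith
  have : ((L : ℝ) / 2) ^ 2 ≤ ‖∑ n ∈ Finset.range L, e (n * θ)‖ ^ 2 := by gcongr
  calc (L : ℝ) / 4 = (1 / L) * (((L : ℝ) / 2) ^ 2) := by field_simp; ring
    _ ≤ _ := by gcongr

lemma aux_fejer_sum {ι : Type*} (I : Finset ι) (θ : ι → ℝ) (L : ℕ) (hL : 1 ≤ L) :
    ∑ i ∈ I, (1 / (L : ℝ)) * ‖∑ n ∈ Finset.range L, e (n * θ i)‖ ^ 2 ≤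
      2 * ∑ u ∈ Finset.range L, ‖∑ i ∈ I, e (u * θ i)‖ := by
  have hL0 : (0 : ℝ) < L := by exact_mod_cast hL
  have h1 : ∀ i, ‖∑ n ∈ Finset.range L, e (n * θ i)‖ ^ 2 ≤
      2 * ∑ u ∈ Finset.range L, ((L - u : ℕ) : ℝ) * (e (u * θ i)).re := by
    intro i
    have h := aux_diff_eq L (fun n => e (n * θ i))
    have h0 : 0 ≤ ∑ m ∈ Finset.range L, ‖e (m * θ i)‖ ^ 2 := Finset.sum_nonneg fun _ _ => by positivity
    have h2 : ∀ u ∈ Finset.range L, (∑ m ∈ Finset.range (L - u),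
        e ((m + u : ℕ) * θ i) * (starRingEnd ℂ) (e (m * θ i))).re = ((L - u : ℕ) : ℝ) * (e (u * θ i)).re := by
      intro u hu
      have : ∀ m ∈ Finset.range (L - u), e ((m + u : ℕ) * θ i) * (starRingEnd ℂ) (e (m * θ i)) = e (u * θ i) := by
        intro m _
        rw [aux_e_conj, ← aux_e_add]
        congr 1; push_cast; ring
      rw [Finset.sum_congr rfl this, Finset.sum_const, Finset.card_range, nsmul_eq_mul]
      simp
    rw [Finset.sum_congr rfl h2] at h
    linarith
  calc ∑ i ∈ I, (1 / (L : ℝ)) * ‖∑ n ∈ Finset.range L, e (n * θ i)‖ ^ 2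
      ≤ ∑ i ∈ I, (1 / (L : ℝ)) * (2 * ∑ u ∈ Finset.range L, ((L - u : ℕ) : ℝ) * (e (u * θ i)).re) := by
        gcongr with i hi
        exact h1 i
    _ = 2 * ∑ u ∈ Finset.range L, (((L - u : ℕ) : ℝ) / L) * (∑ i ∈ I, e (u * θ i)).re := by
        simp_rw [Complex.re_sum, Finset.mul_sum]
        rw [Finset.sum_comm]
        refine Finset.sum_congr rfl fun u _ => Finset.sum_congr rfl fun i _ => ?_
        ring
    _ ≤ _ := by
        gcongr with u hu
        have h3 : ((L - u : ℕ) : ℝ) / L ≤ 1 := by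
          rw [div_le_one hL0]; exact_mod_cast Nat.sub_le _ _
        calc _ ≤ (((L - u : ℕ) : ℝ) / L) * ‖∑ i ∈ I, e (u * θ i)‖ := by
              gcongr; exact Complex.re_le_norm _
          _ ≤ 1 * ‖∑ i ∈ I, e (u * θ i)‖ := by gcongr
          _ = _ := one_mul _

lemma aux_min_fejer (θ H : ℝ) (hH : 1 ≤ H) (hθ : nint θ ≠ 0) :
    min H (1 / nint θ) ≤ 16 * ∑ k ∈ Finset.range (Nat.log 2 ⌊H⌋₊ + 1),
      (1 / ((2 ^ k : ℕ) : ℝ)) * ‖∑ n ∈ Finset.range (2 ^ k), e (n * θ)‖ ^ 2 := by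
  have htpos : 0 < nint θ := lt_of_le_of_ne (aux_nint_nonneg θ) (Ne.symm hθ)
  have ht2 := aux_nint_le θ
  set t := nint θ
  set Y := min H (1 / (2 * t)) with hY
  have hY1 : 1 ≤ Y := by
    refine le_min hH ?_
    rw [le_div_iff₀ (by positivity)]; linarith
  set k := Nat.log 2 ⌊Y⌋₊ with hk
  have hfl : ⌊Y⌋₊ ≠ 0 := by
    have : 1 ≤ ⌊Y⌋₊ := Nat.le_floor (by simpa using hY1)
    omega
  have hkY : ((2 ^ k : ℕ) : ℝ) ≤ Y := by
    have := Nat.pow_log_le_self 2 hfl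
    exact (Nat.le_floor_iff (by linarith)).1 this
  have hYk : Y < 2 * ((2 ^ k : ℕ) : ℝ) := by
    have := Nat.lt_pow_succ_log_self (b := 2) (by norm_num) ⌊Y⌋₊
    have h2 := (Nat.floor_lt (by linarith)).1 this
    rw [pow_succ] at h2
    push_cast at h2 ⊢
    linarith
  have hkK : k ∈ Finset.range (Nat.log 2 ⌊H⌋₊ + 1) := by
    rw [Finset.mem_range, Nat.lt_succ_iff]
    exact Nat.log_mono_right (Nat.floor_mono (min_le_left _ _))
  have hlow := aux_fejer_lower θ (2 ^ k) Nat.one_le_two_pow (by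
    have : ((2 ^ k : ℕ) : ℝ) ≤ 1 / (2 * t) := hkY.trans (min_le_right _ _)
    have hp : (0 : ℝ) < ((2 ^ k : ℕ) : ℝ) := by positivity
    rw [le_div_iff₀ (by positivity)] at this ⊢
    change t * _ ≤ 1
    linarith)
  have hsingle := Finset.single_le_sum (f := fun k : ℕ =>
    (1 / ((2 ^ k : ℕ) : ℝ)) * ‖∑ n ∈ Finset.range (2 ^ k), e (n * θ)‖ ^ 2)
    (fun i _ => by positivity) hkK
  have hmin : min H (1 / t) ≤ 2 * Y := by
    rw [hY, mul_min_of_nonneg _ _ (by norm_num)]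
    apply le_min
    · exact (min_le_left _ _).trans (by linarith)
    · refine (min_le_right _ _).trans (le_of_eq ?_)
      field_simp
  linarith

lemma aux_min_sum {ι : Type*} (I : Finset ι) (θ : ι → ℝ) (H : ℝ) (hH : 1 ≤ H)
    (hθ : ∀ i ∈ I, nint (θ i) ≠ 0) :
    ∑ i ∈ I, min H (1 / nint (θ i)) ≤ 32 * ((Nat.log 2 ⌊H⌋₊ + 1 : ℕ) : ℝ) *
      ∑ u ∈ Finset.range (⌊H⌋₊ + 1), ‖∑ i ∈ I, e (u * θ i)‖ := by
  have hfl : ⌊H⌋₊ ≠ 0 := by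
    have : 1 ≤ ⌊H⌋₊ := Nat.le_floor (by simpa using hH)
    omega
  calc ∑ i ∈ I, min H (1 / nint (θ i))
      ≤ ∑ i ∈ I, 16 * ∑ k ∈ Finset.range (Nat.log 2 ⌊H⌋₊ + 1),
      (1 / ((2 ^ k : ℕ) : ℝ)) * ‖∑ n ∈ Finset.range (2 ^ k), e (n * θ i)‖ ^ 2 :=
        Finset.sum_le_sum fun i hi => aux_min_fejer _ _ hH (hθ i hi)
    _ = 16 * ∑ k ∈ Finset.range (Nat.log 2 ⌊H⌋₊ + 1), ∑ i ∈ I,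
      (1 / ((2 ^ k : ℕ) : ℝ)) * ‖∑ n ∈ Finset.range (2 ^ k), e (n * θ i)‖ ^ 2 := by
        rw [← Finset.mul_sum, Finset.sum_comm]
    _ ≤ 16 * ∑ k ∈ Finset.range (Nat.log 2 ⌊H⌋₊ + 1), 2 *
        ∑ u ∈ Finset.range (⌊H⌋₊ + 1), ‖∑ i ∈ I, e (u * θ i)‖ := by
        gcongr with k hk
        refine (aux_fejer_sum I θ (2 ^ k) Nat.one_le_two_pow).trans ?_
        gcongr
        rw [Finset.mem_range, Nat.lt_succ_iff] at hk
        have := (Nat.pow_le_pow_right (n := 2) (by norm_num) hk).trans (Nat.pow_log_le_self 2 hfl)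
        omega
    _ = _ := by
        rw [Finset.sum_const, Finset.card_range, nsmul_eq_mul]; ring


lemma aux_harm (Q : ℕ) (hQ : 1 ≤ Q) : ∑ b ∈ Finset.range Q, (1 : ℝ) / b ≤ 1 + Real.log Q := by
  obtain ⟨n, rfl⟩ : ∃ n, Q = n + 1 := ⟨Q - 1, by omega⟩
  rw [Finset.sum_range_succ']
  have h := harmonic_le_one_add_log n
  have h2 : ∑ k ∈ Finset.range n, (1 : ℝ) / ((k + 1 : ℕ) : ℝ) = ((harmonic n : ℚ) : ℝ) := by
    unfold harmonic; push_cast; simp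
  rw [h2]
  have h3 : Real.log n ≤ Real.log ((n + 1 : ℕ) : ℝ) := by
    rcases Nat.eq_zero_or_pos n with h0 | h0
    · subst h0; simp
    · apply Real.log_le_log
      · exact_mod_cast h0
      · push_cast; linarith
  simp only [Nat.cast_zero, div_zero, add_zero]
  linarith

lemma aux_block (α : ℝ) (a : ℤ) (q : ℕ) (hq : 1 ≤ q) (hgcd : Int.gcd a q = 1)
    (hα : |α - (a : ℝ) / q| < 1 / (q : ℝ) ^ 2) (M : ℝ) (hM : 0 ≤ M) (T : Finset ℕ)
    (hT : ∀ n ∈ T, ∀ n' ∈ T, n < n' → 2 * (n' - n) < q) :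
    ∑ n ∈ T, min M (1 / nint (α * n)) ≤ 2 * M + 4 * q * (1 + Real.log (2 * q)) := by
  have hq0 : (0 : ℝ) < q := by exact_mod_cast hq
  set b : ℕ → ℕ := fun n => ⌊2 * (q : ℝ) * Int.fract (α * n)⌋₊ with hb
  have hb1 : ∀ n : ℕ, (b n : ℝ) ≤ 2 * q * Int.fract (α * n) := fun n =>
    Nat.floor_le (by have := Int.fract_nonneg (α * n); positivity)
  have hb2 : ∀ n : ℕ, 2 * q * Int.fract (α * n) < b n + 1 := fun n => Nat.lt_floor_add_one _
  have hbr : ∀ n : ℕ, b n < 2 * q := by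
    intro n
    have h1 := hb1 n
    have h2 := Int.fract_lt_one (α * n)
    have : (b n : ℝ) < ((2 * q : ℕ) : ℝ) := by push_cast; nlinarith
    exact_mod_cast this
  have hinj : ∀ n ∈ T, ∀ n' ∈ T, n < n' → b n ≠ b n' := by
    intro n hn n' hn' hlt heq
    have hd := hT n hn n' hn' hlt
    set d : ℕ := n' - n with hdd
    have hd1 : 1 ≤ d := by omega
    have hcast : (n' : ℝ) = n + d := by
      have : n' = n + d := by omega
      rw [this]; push_cast; ring
    have e1 := hb1 n
    have e2 := hb2 n
    have e3 := hb1 n'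
    have e4 := hb2 n'
    rw [← heq] at e3 e4
    set k : ℤ := ⌊α * n'⌋ - ⌊α * n⌋ with hk
    have hf : Int.fract (α * n') - Int.fract (α * n) = α * d - k := by
      rw [hk, Int.fract, Int.fract, hcast]; push_cast; ring
    have h1 : |2 * q * (α * d - k)| < 1 := by
      rw [← hf, abs_lt]; constructor <;> linarith
    have h2 : |2 * q * (α * d - a * d / q)| < 1 := by
      have : 2 * (q : ℝ) * (α * d - a * d / q) = 2 * q * d * (α - a / q) := by ring
      rw [this, abs_mul, abs_of_nonneg (by positivity)]
      have hd' : 2 * (d : ℝ) ≤ q := by exact_mod_cast hd.le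
      have hd0 : (0 : ℝ) < d := by exact_mod_cast hd1
      calc 2 * (q : ℝ) * d * |α - a / q| < 2 * q * d * (1 / (q : ℝ) ^ 2) := by gcongr
        _ = 2 * d / q := by field_simp
        _ ≤ 1 := by rw [div_le_one hq0]; exact hd'
    have h3 : |((a * d - k * q : ℤ) : ℝ)| < 1 := by
      have : (((a * d - k * q : ℤ) : ℝ)) = (2 * q * (α * d - k) - 2 * q * (α * d - a * d / q)) / 2 := by
        push_cast; field_simp; ring
      rw [this, abs_lt]
      rw [abs_lt] at h1 h2
      constructor <;> linarith
    have h4 : a * d - k * q = 0 := by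
      have : |a * d - k * q| < 1 := by exact_mod_cast h3
      exact Int.abs_lt_one_iff.1 this
    have h5 : (q : ℤ) ∣ a * d := ⟨k, by linarith⟩
    have h6 : (q : ℤ) ∣ (d : ℤ) := by
      apply Int.dvd_of_dvd_mul_right_of_gcd_one h5
      rw [Int.gcd_comm]; exact hgcd
    have h7 : q ∣ d := by exact_mod_cast h6
    have := Nat.le_of_dvd (by omega) h7
    omega
  set g : ℕ → ℝ := fun c => (if c = 0 then M else 0) + (if c = 2 * q - 1 then M else 0)
    + 2 * q * (1 / (c : ℝ)) + 2 * q * (1 / ((2 * q - 1 - c : ℕ) : ℝ)) with hg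
  have hg0 : ∀ c, 0 ≤ g c := by
    intro c
    simp only [hg]
    have : (0 : ℝ) ≤ if c = 0 then M else 0 := by split_ifs <;> simp [hM]
    have : (0 : ℝ) ≤ if c = 2 * q - 1 then M else 0 := by split_ifs <;> simp [hM]
    positivity
  have hterm : ∀ n ∈ T, min M (1 / nint (α * n)) ≤ g (b n) := by
    intro n _
    have p1 : 0 ≤ 2 * q * (1 / (b n : ℝ)) := by positivity
    have p2 : 0 ≤ 2 * q * (1 / ((2 * q - 1 - b n : ℕ) : ℝ)) := by positivity
    have p3 : (0 : ℝ) ≤ if b n = 0 then M else 0 := by split_ifs <;> simp [hM]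
    have p4 : (0 : ℝ) ≤ if b n = 2 * q - 1 then M else 0 := by split_ifs <;> simp [hM]
    by_cases c1 : b n = 0
    · refine (min_le_left _ _).trans ?_
      simp only [hg]
      have : (if b n = 0 then M else 0) = M := if_pos c1
      linarith
    by_cases c2 : b n = 2 * q - 1
    · refine (min_le_left _ _).trans ?_
      simp only [hg]
      have : (if b n = 2 * q - 1 then M else 0) = M := if_pos c2
      linarith
    refine (min_le_right _ _).trans ?_
    have hbn := hbr n
    have f1 : (1 : ℝ) ≤ b n := by exact_mod_cast Nat.one_le_iff_ne_zero.2 c1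
    set r : ℕ := 2 * q - 1 - b n with hr
    have f2 : (1 : ℝ) ≤ r := by exact_mod_cast (by omega : 1 ≤ r)
    have f3 : (r : ℝ) = 2 * q - 1 - b n := by
      have : r + 1 + b n = 2 * q := by omega
      have : (r : ℝ) + 1 + b n = 2 * q := by exact_mod_cast this
      linarith
    have e1 := hb1 n
    have e2 := hb2 n
    unfold nint
    rw [abs_sub_round_eq_min]
    set f := Int.fract (α * n)
    have i1 : 1 / f ≤ 2 * q * (1 / (b n : ℝ)) := by
      have : 0 < f := by
        by_contra hc; push Not at hc; nlinarith
      rw [mul_one_div, div_le_div_iff₀ this (by linarith)]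
      linarith
    have i2 : 1 / (1 - f) ≤ 2 * q * (1 / (r : ℝ)) := by
      have : 0 < 1 - f := by
        by_contra hc; push Not at hc; nlinarith
      rw [mul_one_div, div_le_div_iff₀ this (by linarith)]
      linarith
    simp only [hg]
    rcases min_choice f (1 - f) with h | h <;> rw [h] <;> linarith
  have hbinj : Set.InjOn b (T : Set ℕ) := by
    intro n hn n' hn' heq
    rcases lt_trichotomy n n' with h | h | h
    · exact absurd heq (hinj n hn n' hn' h)
    · exact h
    · exact absurd heq.symm (hinj n' hn' n hn h)
  have hharm := aux_harm (2 * q) (by omega)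
  push_cast at hharm
  calc ∑ n ∈ T, min M (1 / nint (α * n)) ≤ ∑ n ∈ T, g (b n) := Finset.sum_le_sum hterm
    _ = ∑ c ∈ T.image b, g c := (Finset.sum_image hbinj).symm
    _ ≤ ∑ c ∈ Finset.range (2 * q), g c := by
        apply Finset.sum_le_sum_of_subset_of_nonneg
        · intro c hc
          rw [Finset.mem_image] at hc
          obtain ⟨n, _, rfl⟩ := hc
          exact Finset.mem_range.2 (hbr n)
        · intro c _ _; exact hg0 c
    _ ≤ 2 * M + 4 * q * (1 + Real.log (2 * q)) := by
        simp only [hg]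
        rw [Finset.sum_add_distrib, Finset.sum_add_distrib, Finset.sum_add_distrib,
          ← Finset.mul_sum, ← Finset.mul_sum,
          Finset.sum_range_reflect (fun c : ℕ => (1 : ℝ) / (c : ℝ)) (2 * q)]
        rw [Finset.sum_ite_eq', Finset.sum_ite_eq',
          if_pos (Finset.mem_range.2 (by omega)), if_pos (Finset.mem_range.2 (by omega))]
        nlinarith

lemma aux_minsum (α : ℝ) (a : ℤ) (q : ℕ) (hq : 1 ≤ q) (hgcd : Int.gcd a q = 1)
    (hα : |α - (a : ℝ) / q| < 1 / (q : ℝ) ^ 2) (M : ℝ) (hM : 0 ≤ M) (N : ℕ) :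
    ∑ n ∈ Finset.Icc 1 N, min M (1 / nint (α * n)) ≤
      (2 * N / q + 1) * (2 * M + 4 * q * (1 + Real.log (2 * q))) := by
  have hq0 : (0 : ℝ) < q := by exact_mod_cast hq
  set h : ℕ := (q + 1) / 2 with hh
  have hh1 : 1 ≤ h := by omega
  have hhq : (q : ℝ) ≤ 2 * h := by exact_mod_cast (by omega : q ≤ 2 * h)
  have hh0 : (0 : ℝ) < h := by exact_mod_cast hh1
  have hlog : 0 ≤ Real.log (2 * q) := Real.log_nonneg (by
    have : (1 : ℝ) ≤ q := by exact_mod_cast hq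
    linarith)
  have hmap : ∀ n ∈ Finset.Icc 1 N, n / h ∈ Finset.range (N / h + 1) := by
    intro n hn
    rw [Finset.mem_range, Nat.lt_succ_iff]
    exact Nat.div_le_div_right (Finset.mem_Icc.1 hn).2
  rw [← Finset.sum_fiberwise_of_maps_to hmap]
  calc _ ≤ ∑ k ∈ Finset.range (N / h + 1), (2 * M + 4 * q * (1 + Real.log (2 * q))) := by
        apply Finset.sum_le_sum
        intro k _
        apply aux_block α a q hq hgcd hα M hM
        intro n hn n' hn' hlt
        simp only [Finset.mem_filter] at hn hn'
        have a1 : k * h ≤ n := by rw [← hn.2]; exact Nat.div_mul_le_self n h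
        have a2 : n' < k * h + h := by
          have := Nat.lt_div_mul_add (a := n') (b := h) (by omega)
          rw [hn'.2] at this; exact this
        omega
    _ = ((N / h : ℕ) + 1 : ℝ) * (2 * M + 4 * q * (1 + Real.log (2 * q))) := by
        rw [Finset.sum_const, Finset.card_range, nsmul_eq_mul]; push_cast; ring
    _ ≤ _ := by
        gcongr
        calc ((N / h : ℕ) : ℝ) ≤ (N : ℝ) / h := Nat.cast_div_le
          _ ≤ 2 * N / q := by
            rw [div_le_div_iff₀ hh0 hq0]
            have : (0 : ℝ) ≤ N := by positivity
            nlinarith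

lemma aux_fiber (A B C D E : Finset ℕ) (w : ℕ → ℝ) (hw : ∀ n, 0 ≤ w n) (N : ℕ) (K : ℝ)
    (hK : ∀ n ∈ Finset.Icc 1 N, (n.divisors.card : ℝ) ^ 5 ≤ K)
    (hN : ∀ h ∈ A, ∀ s ∈ B, ∀ j ∈ C, ∀ u ∈ D, ∀ v ∈ E, h * s ^ 2 * j * (6 * u * v) ∈ Finset.Icc 1 N) :
    ∑ h ∈ A, ∑ s ∈ B, ∑ j ∈ C, ∑ u ∈ D, ∑ v ∈ E, w (h * s ^ 2 * j * (6 * u * v)) ≤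
      K * ∑ n ∈ Finset.Icc 1 N, w n := by
  classical
  set I := A ×ˢ B ×ˢ C ×ˢ D ×ˢ E with hI
  set φ : ℕ × ℕ × ℕ × ℕ × ℕ → ℕ := fun t => t.1 * t.2.1 ^ 2 * t.2.2.1 * (6 * t.2.2.2.1 * t.2.2.2.2) with hφ
  have h1 : ∑ h ∈ A, ∑ s ∈ B, ∑ j ∈ C, ∑ u ∈ D, ∑ v ∈ E, w (h * s ^ 2 * j * (6 * u * v)) =
      ∑ t ∈ I, w (φ t) := by
    rw [hI]
    simp only [Finset.sum_product, hφ]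
  have hmap : ∀ t ∈ I, φ t ∈ Finset.Icc 1 N := by
    intro t ht
    simp only [hI, Finset.mem_product] at ht
    exact hN _ ht.1 _ ht.2.1 _ ht.2.2.1 _ ht.2.2.2.1 _ ht.2.2.2.2
  rw [h1, ← Finset.sum_fiberwise_of_maps_to hmap, Finset.mul_sum]
  apply Finset.sum_le_sum
  intro n hn
  have hn0 : n ≠ 0 := by have := (Finset.mem_Icc.1 hn).1; omega
  have h2 : ∑ t ∈ I with φ t = n, w (φ t) = ((I.filter (fun t => φ t = n)).card : ℝ) * w n := by
    rw [Finset.sum_congr rfl (g := fun _ => w n)]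
    · simp
    · intro t ht; rw [(Finset.mem_filter.1 ht).2]
  rw [h2]
  apply mul_le_mul_of_nonneg_right _ (hw n)
  refine le_trans ?_ (hK n hn)
  have h3 : (I.filter (fun t => φ t = n)) ⊆
      n.divisors ×ˢ n.divisors ×ˢ n.divisors ×ˢ n.divisors ×ˢ n.divisors := by
    intro t ht
    have ht2 := (Finset.mem_filter.1 ht).2
    simp only [Finset.mem_product, Nat.mem_divisors]
    simp only [hφ] at ht2
    refine ⟨⟨?_, hn0⟩, ⟨?_, hn0⟩, ⟨?_, hn0⟩, ⟨?_, hn0⟩, ⟨?_, hn0⟩⟩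
    · exact ⟨t.2.1 ^ 2 * t.2.2.1 * (6 * t.2.2.2.1 * t.2.2.2.2), by rw [← ht2]; ring⟩
    · exact ⟨t.1 * t.2.1 * t.2.2.1 * (6 * t.2.2.2.1 * t.2.2.2.2), by rw [← ht2]; ring⟩
    · exact ⟨t.1 * t.2.1 ^ 2 * (6 * t.2.2.2.1 * t.2.2.2.2), by rw [← ht2]; ring⟩
    · exact ⟨t.1 * t.2.1 ^ 2 * t.2.2.1 * (6 * t.2.2.2.2), by rw [← ht2]; ring⟩
    · exact ⟨t.1 * t.2.1 ^ 2 * t.2.2.1 * (6 * t.2.2.2.1), by rw [← ht2]; ring⟩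
  have h4 := Finset.card_le_card h3
  simp only [Finset.card_product] at h4
  calc ((I.filter (fun t => φ t = n)).card : ℝ) ≤ ((n.divisors.card * (n.divisors.card *
      (n.divisors.card * (n.divisors.card * n.divisors.card))) : ℕ) : ℝ) := by exact_mod_cast h4
    _ = _ := by push_cast; ring


lemma aux_dyad_mem {X : ℝ} (hX : 0 < X) {n : ℕ} (hn : n ∈ dyad X) :
    X / 2 ≤ n ∧ (n : ℝ) < X ∧ 1 ≤ n := by
  unfold dyad at hn
  rw [Finset.mem_Ico] at hn
  refine ⟨Nat.ceil_le.1 hn.1, Nat.lt_ceil.1 hn.2, ?_⟩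
  have : 0 < ⌈X / 2⌉₊ := Nat.ceil_pos.2 (by positivity)
  omega

lemma aux_dyad_card {X : ℝ} (hX : 0 < X) : ((dyad X).card : ℝ) ≤ X := by
  unfold dyad
  rw [Nat.card_Ico]
  have h1 : 0 < ⌈X / 2⌉₊ := Nat.ceil_pos.2 (by positivity)
  have h2 : 0 < ⌈X⌉₊ := Nat.ceil_pos.2 hX
  have h3 : ⌈X⌉₊ - ⌈X / 2⌉₊ < ⌈X⌉₊ := by omega
  exact (Nat.lt_ceil.1 h3).le

lemma aux_nint_irr {α : ℝ} (hα : Irrational α) {n : ℕ} (hn : 1 ≤ n) : nint (α * n) ≠ 0 := by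
  unfold nint
  intro h
  rw [abs_eq_zero, sub_eq_zero] at h
  have h2 : Irrational (α * (n : ℝ)) := hα.mul_natCast (by omega)
  exact (h2.ne_int _) h

/-- the exponential sum over `m` -/
def auxT (α M : ℝ) (k : ℕ) : ℝ := ‖∑ m ∈ dyad M, e (α * k * (m : ℝ) ^ 3)‖

lemma auxT_nonneg (α M : ℝ) (k : ℕ) : 0 ≤ auxT α M k := norm_nonneg _

lemma aux_T4 {α : ℝ} (hα : Irrational α) {M : ℝ} (hM : 0 < M) (k : ℕ) (hk : 1 ≤ k) :
    auxT α M k ^ 4 ≤ 8 * M * (2 * M ^ 2 + ∑ u ∈ Finset.Ico 1 (dyad M).card,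
      ∑ v ∈ Finset.Ico 1 (dyad M).card, min M (1 / nint (α * ((k * (6 * u * v) : ℕ) : ℝ)))) := by
  have hcard := aux_dyad_card hM
  set L := (dyad M).card with hL
  have hsum : auxT α M k = ‖∑ m ∈ Finset.range L, e ((α * k) * ((m + ⌈M / 2⌉₊ : ℕ) : ℝ) ^ 3)‖ := by
    unfold auxT
    have : L = ⌈M⌉₊ - ⌈M / 2⌉₊ := by rw [hL]; unfold dyad; rw [Nat.card_Ico]
    rw [this]
    unfold dyad
    rw [Finset.sum_Ico_eq_sum_range]
    congr 1
    refine Finset.sum_congr rfl fun m _ => ?_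
    rw [add_comm]
  have hcast : ∀ u v : ℕ, α * k * (6 * u * v) = α * ((k * (6 * u * v) : ℕ) : ℝ) := by
    intro u v; push_cast; ring
  have hw := aux_weyl (α * k) ⌈M / 2⌉₊ L (by
    intro u v hu hv
    rw [hcast]
    apply aux_nint_irr hα
    have : 0 < k * (6 * u * v) := by positivity
    omega)
  rw [← hsum] at hw
  refine hw.trans ?_
  have hL0 : (0 : ℝ) ≤ L := by positivity
  have hs : ∑ u ∈ Finset.Ico 1 L, ∑ v ∈ Finset.Ico 1 L, min (L : ℝ) (1 / nint (α * k * (6 * u * v))) ≤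
      ∑ u ∈ Finset.Ico 1 L, ∑ v ∈ Finset.Ico 1 L, min M (1 / nint (α * ((k * (6 * u * v) : ℕ) : ℝ))) := by
    refine Finset.sum_le_sum fun u _ => Finset.sum_le_sum fun v _ => ?_
    rw [hcast]
    exact min_le_min_right _ hcard
  have hs0 : 0 ≤ ∑ u ∈ Finset.Ico 1 L, ∑ v ∈ Finset.Ico 1 L, min (L : ℝ) (1 / nint (α * k * (6 * u * v))) := by
    refine Finset.sum_nonneg fun u _ => Finset.sum_nonneg fun v _ => ?_
    exact le_min hL0 (div_nonneg zero_le_one (aux_nint_nonneg _))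
  have : (L : ℝ) ^ 2 ≤ M ^ 2 := by gcongr
  calc 8 * (L : ℝ) * (2 * (L : ℝ) ^ 2 + ∑ u ∈ Finset.Ico 1 L, ∑ v ∈ Finset.Ico 1 L, min (L : ℝ) (1 / nint (α * k * (6 * u * v))))
      ≤ 8 * M * (2 * (L : ℝ) ^ 2 + ∑ u ∈ Finset.Ico 1 L, ∑ v ∈ Finset.Ico 1 L, min (L : ℝ) (1 / nint (α * k * (6 * u * v)))) := by
        gcongr
    _ ≤ _ := by
        gcongr 8 * M * (?_ + ?_)
        linarith

lemma aux_pow_four {ι : Type*} (Q : Finset ι) (f : ι → ℝ) :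
    (∑ t ∈ Q, f t) ^ 4 ≤ (Q.card : ℝ) ^ 3 * ∑ t ∈ Q, f t ^ 4 := by
  have h1 := sq_sum_le_card_mul_sum_sq (s := Q) (f := f)
  have h2 := sq_sum_le_card_mul_sum_sq (s := Q) (f := fun t => f t ^ 2)
  have h0 : 0 ≤ (∑ t ∈ Q, f t) ^ 2 := by positivity
  calc (∑ t ∈ Q, f t) ^ 4 = ((∑ t ∈ Q, f t) ^ 2) ^ 2 := by ring
    _ ≤ (Q.card * ∑ t ∈ Q, f t ^ 2) ^ 2 := by gcongr
    _ = (Q.card : ℝ) ^ 2 * (∑ t ∈ Q, f t ^ 2) ^ 2 := by ring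
    _ ≤ (Q.card : ℝ) ^ 2 * (Q.card * ∑ t ∈ Q, (f t ^ 2) ^ 2) := by gcongr
    _ = (Q.card : ℝ) ^ 3 * ∑ t ∈ Q, f t ^ 4 := by
      simp_rw [← pow_mul]; ring

/-- The sum of exponential sums. -/
def auxV (α M S J H : ℝ) : ℝ :=
  ∑ h ∈ Finset.Icc 1 ⌊H⌋₊, ∑ s ∈ dyad S, ∑ j ∈ dyad J, auxT α M (h * s ^ 2 * j)

lemma aux_V4 {α : ℝ} (hα : Irrational α) (a : ℤ) (q : ℕ) (hq : 1 ≤ q) (hgcd : Int.gcd a q = 1)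
    (hαq : |α - (a : ℝ) / q| < 1 / (q : ℝ) ^ 2)
    {M S J H : ℝ} (hM : 0 < M) (hS : 0 < S) (hJ : 0 < J) (hH : 1 ≤ H) (K : ℝ)
    (hK : ∀ n ∈ Finset.Icc 1 ⌊6 * H * S ^ 2 * J * M ^ 2⌋₊, (n.divisors.card : ℝ) ^ 5 ≤ K) (hK1 : 0 ≤ K) :
    auxV α M S J H ^ 4 ≤ (H * S * J) ^ 3 * (8 * M * (2 * M ^ 2 * (H * S * J) +
      K * ((2 * (6 * H * S ^ 2 * J * M ^ 2) / q + 1) * (2 * M + 4 * q * (1 + Real.log (2 * q)))))) := by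
  have hq0 : (0 : ℝ) < q := by exact_mod_cast hq
  have hlog : 0 ≤ Real.log (2 * q) := Real.log_nonneg (by
    have : (1 : ℝ) ≤ q := by exact_mod_cast hq
    linarith)
  set N := ⌊6 * H * S ^ 2 * J * M ^ 2⌋₊ with hN
  set L := (dyad M).card with hL
  have hLM : (L : ℝ) ≤ M := aux_dyad_card hM
  set Q := Finset.Icc 1 ⌊H⌋₊ ×ˢ dyad S ×ˢ dyad J with hQ
  have hcard : (Q.card : ℝ) ≤ H * S * J := by
    rw [hQ, Finset.card_product, Finset.card_product, Nat.card_Icc]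
    have h1 : ((⌊H⌋₊ + 1 - 1 : ℕ) : ℝ) ≤ H := by
      rw [Nat.add_sub_cancel]; exact Nat.floor_le (by linarith)
    have h2 := aux_dyad_card hS
    have h3 := aux_dyad_card hJ
    rw [Nat.add_sub_cancel] at h1 ⊢
    push_cast
    rw [mul_assoc]
    gcongr
  have hV : auxV α M S J H = ∑ t ∈ Q, auxT α M (t.1 * t.2.1 ^ 2 * t.2.2) := by
    unfold auxV; rw [hQ]; simp only [Finset.sum_product]
  have hV4 : auxV α M S J H ^ 4 ≤ (H * S * J) ^ 3 * ∑ t ∈ Q, auxT α M (t.1 * t.2.1 ^ 2 * t.2.2) ^ 4 := by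
    rw [hV]
    have h0 : 0 ≤ ∑ t ∈ Q, auxT α M (t.1 * t.2.1 ^ 2 * t.2.2) ^ 4 :=
      Finset.sum_nonneg fun _ _ => by positivity
    have := aux_pow_four Q (fun t => auxT α M (t.1 * t.2.1 ^ 2 * t.2.2))
    refine this.trans ?_
    gcongr
  refine hV4.trans ?_
  apply mul_le_mul_of_nonneg_left _ (by positivity)
  set w : ℕ → ℝ := fun n => min M (1 / nint (α * (n : ℝ))) with hw
  have hw0 : ∀ n, 0 ≤ w n := fun n => le_min hM.le (div_nonneg zero_le_one (aux_nint_nonneg _))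
  have hpos : ∀ t ∈ Q, 1 ≤ t.1 * t.2.1 ^ 2 * t.2.2 := by
    intro t ht
    simp only [hQ, Finset.mem_product, Finset.mem_Icc] at ht
    have h1 := (aux_dyad_mem hS ht.2.1).2.2
    have h2 := (aux_dyad_mem hJ ht.2.2).2.2
    have h3 := ht.1.1
    have : 0 < t.1 * t.2.1 ^ 2 * t.2.2 := by positivity
    omega
  calc ∑ t ∈ Q, auxT α M (t.1 * t.2.1 ^ 2 * t.2.2) ^ 4
      ≤ ∑ t ∈ Q, 8 * M * (2 * M ^ 2 + ∑ u ∈ Finset.Ico 1 L, ∑ v ∈ Finset.Ico 1 L,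
          w (t.1 * t.2.1 ^ 2 * t.2.2 * (6 * u * v))) :=
        Finset.sum_le_sum fun t ht => aux_T4 hα hM _ (hpos t ht)
    _ = 8 * M * (2 * M ^ 2 * Q.card + ∑ h ∈ Finset.Icc 1 ⌊H⌋₊, ∑ s ∈ dyad S, ∑ j ∈ dyad J,
          ∑ u ∈ Finset.Ico 1 L, ∑ v ∈ Finset.Ico 1 L, w (h * s ^ 2 * j * (6 * u * v))) := by
        rw [← Finset.mul_sum, Finset.sum_add_distrib, Finset.sum_const, nsmul_eq_mul]
        congr 2
        · ring
        · rw [hQ]; simp only [Finset.sum_product]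
    _ ≤ 8 * M * (2 * M ^ 2 * (H * S * J) + K * ∑ n ∈ Finset.Icc 1 N, w n) := by
        gcongr
        apply aux_fiber _ _ _ _ _ w hw0 N K hK
        intro h hh s hs j hj u hu v hv
        rw [Finset.mem_Icc] at hh ⊢
        rw [Finset.mem_Ico] at hu hv
        have hs' := aux_dyad_mem hS hs
        have hj' := aux_dyad_mem hJ hj
        constructor
        · have a1 := hh.1
          have a2 := hs'.2.2
          have a3 := hj'.2.2
          have a4 := hu.1
          have a5 := hv.1
          have : 0 < h * s ^ 2 * j * (6 * u * v) := by positivity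
          omega
        · apply Nat.le_floor
          push_cast
          have b1 : (h : ℝ) ≤ H := (Nat.le_floor_iff (by linarith)).1 hh.2
          have b2 : (s : ℝ) ≤ S := hs'.2.1.le
          have b3 : (j : ℝ) ≤ J := hj'.2.1.le
          have b4 : (u : ℝ) ≤ M := le_trans (by exact_mod_cast hu.2.le) hLM
          have b5 : (v : ℝ) ≤ M := le_trans (by exact_mod_cast hv.2.le) hLM
          calc (h : ℝ) * s ^ 2 * j * (6 * u * v) ≤ H * S ^ 2 * J * (6 * M * M) := by gcongr
            _ = _ := by ring
    _ ≤ _ := by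
        have h1 := aux_minsum α a q hq hgcd hαq M hM.le N
        have hNle : (N : ℝ) ≤ 6 * H * S ^ 2 * J * M ^ 2 := Nat.floor_le (by positivity)
        gcongr
        refine h1.trans ?_
        gcongr


/-- The sum without divisor weights. -/
def auxG (α x M S J : ℝ) : ℝ :=
  ∑ m ∈ dyad M, ∑ s ∈ dyad S, ∑ j ∈ dyad J,
        min (x / ((m : ℝ) ^ 3 * (s : ℝ) ^ 2 * (j : ℝ)))
          (1 / nint (α * ((m : ℝ) ^ 3 * (s : ℝ) ^ 2 * (j : ℝ))))

lemma aux_G_tau (α x M S J B : ℝ) (μ σ ζ : ℕ) (hB : 0 ≤ B) (hx : 0 ≤ x)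
    (h1 : ∀ m ∈ dyad M, (tauk μ m : ℝ) ≤ B) (h2 : ∀ m ∈ dyad S, (tauk σ m : ℝ) ≤ B)
    (h3 : ∀ m ∈ dyad J, (tauk ζ m : ℝ) ≤ B) :
    Gsum α x M S J μ σ ζ ≤ B ^ 3 * auxG α x M S J := by
  have hmin : ∀ m s j : ℕ, 0 ≤ min (x / ((m : ℝ) ^ 3 * (s : ℝ) ^ 2 * (j : ℝ)))
          (1 / nint (α * ((m : ℝ) ^ 3 * (s : ℝ) ^ 2 * (j : ℝ)))) := fun m s j =>
    le_min (by positivity) (div_nonneg zero_le_one (aux_nint_nonneg _))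
  unfold Gsum auxG
  rw [Finset.mul_sum]
  apply Finset.sum_le_sum
  intro m hm
  calc _ ≤ (tauk μ m : ℝ) * (B ^ 2 * ∑ s ∈ dyad S, ∑ j ∈ dyad J,
        min (x / ((m : ℝ) ^ 3 * (s : ℝ) ^ 2 * (j : ℝ)))
          (1 / nint (α * ((m : ℝ) ^ 3 * (s : ℝ) ^ 2 * (j : ℝ))))) := by
        apply mul_le_mul_of_nonneg_left _ (by positivity)
        rw [Finset.mul_sum]
        apply Finset.sum_le_sum
        intro s hs
        calc _ ≤ (tauk σ s : ℝ) * (B * ∑ j ∈ dyad J,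
            min (x / ((m : ℝ) ^ 3 * (s : ℝ) ^ 2 * (j : ℝ)))
              (1 / nint (α * ((m : ℝ) ^ 3 * (s : ℝ) ^ 2 * (j : ℝ))))) := by
              apply mul_le_mul_of_nonneg_left _ (by positivity)
              rw [Finset.mul_sum]
              apply Finset.sum_le_sum
              intro j hj
              exact mul_le_mul_of_nonneg_right (h3 j hj) (hmin m s j)
          _ ≤ B * (B * ∑ j ∈ dyad J,
            min (x / ((m : ℝ) ^ 3 * (s : ℝ) ^ 2 * (j : ℝ)))
              (1 / nint (α * ((m : ℝ) ^ 3 * (s : ℝ) ^ 2 * (j : ℝ))))) := by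
              apply mul_le_mul_of_nonneg_right (h2 s hs)
              exact mul_nonneg hB (Finset.sum_nonneg fun j _ => hmin m s j)
          _ = _ := by ring
    _ ≤ B * (B ^ 2 * ∑ s ∈ dyad S, ∑ j ∈ dyad J,
        min (x / ((m : ℝ) ^ 3 * (s : ℝ) ^ 2 * (j : ℝ)))
          (1 / nint (α * ((m : ℝ) ^ 3 * (s : ℝ) ^ 2 * (j : ℝ))))) := by
        apply mul_le_mul_of_nonneg_right (h1 m hm)
        exact mul_nonneg (by positivity)
          (Finset.sum_nonneg fun s _ => Finset.sum_nonneg fun j _ => hmin m s j)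
    _ = _ := by ring

lemma aux_xle {x M S J : ℝ} (hx : 0 < x) (hM : 0 < M) (hS : 0 < S) (hJ : 0 < J) {m s j : ℕ}
    (hm : m ∈ dyad M) (hs : s ∈ dyad S) (hj : j ∈ dyad J) :
    x / ((m : ℝ) ^ 3 * (s : ℝ) ^ 2 * (j : ℝ)) ≤ 64 * x / (M ^ 3 * S ^ 2 * J) := by
  have h1 := (aux_dyad_mem hM hm).1
  have h2 := (aux_dyad_mem hS hs).1
  have h3 := (aux_dyad_mem hJ hj).1
  have h : (M / 2) ^ 3 * (S / 2) ^ 2 * (J / 2) ≤ (m : ℝ) ^ 3 * (s : ℝ) ^ 2 * (j : ℝ) := by gcongr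
  calc x / ((m : ℝ) ^ 3 * (s : ℝ) ^ 2 * (j : ℝ)) ≤ x / ((M / 2) ^ 3 * (S / 2) ^ 2 * (J / 2)) := by
        gcongr
    _ = _ := by field_simp; norm_num

lemma aux_G_triv {α x M S J : ℝ} (hx : 0 < x) (hM : 0 < M) (hS : 0 < S) (hJ : 0 < J) :
    auxG α x M S J ≤ 64 * x / (M ^ 2 * S) := by
  unfold auxG
  calc _ ≤ ∑ m ∈ dyad M, ∑ s ∈ dyad S, ∑ j ∈ dyad J, 64 * x / (M ^ 3 * S ^ 2 * J) :=
        Finset.sum_le_sum fun m hm => Finset.sum_le_sum fun s hs => Finset.sum_le_sum fun j hj =>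
          (min_le_left _ _).trans (aux_xle hx hM hS hJ hm hs hj)
    _ = (dyad M).card * ((dyad S).card * ((dyad J).card * (64 * x / (M ^ 3 * S ^ 2 * J)))) := by
        simp only [Finset.sum_const, nsmul_eq_mul]
    _ ≤ M * (S * (J * (64 * x / (M ^ 3 * S ^ 2 * J)))) := by
        gcongr
        · exact aux_dyad_card hM
        · exact aux_dyad_card hS
        · exact aux_dyad_card hJ
    _ = _ := by field_simp

lemma aux_G_V {α x M S J : ℝ} (hα : Irrational α) (hM : 0 < M) (hS : 0 < S) (hJ : 0 < J)
    (hx : M ^ 3 * S ^ 2 * J < x) :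
    auxG α x M S J ≤ 32 * ((Nat.log 2 ⌊64 * x / (M ^ 3 * S ^ 2 * J)⌋₊ + 1 : ℕ) : ℝ) *
      (M * S * J + auxV α M S J (64 * x / (M ^ 3 * S ^ 2 * J))) := by
  have hden : 0 < M ^ 3 * S ^ 2 * J := by positivity
  have hx0 : 0 < x := hden.trans hx
  set H := 64 * x / (M ^ 3 * S ^ 2 * J) with hH
  have hH1 : 1 ≤ H := by
    rw [hH, le_div_iff₀ hden]; linarith
  set I := dyad M ×ˢ dyad S ×ˢ dyad J with hI
  set θ : ℕ × ℕ × ℕ → ℝ := fun t => α * ((t.1 ^ 3 * t.2.1 ^ 2 * t.2.2 : ℕ) : ℝ) with hθ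
  have h1 : auxG α x M S J ≤ ∑ t ∈ I, min H (1 / nint (θ t)) := by
    rw [hI]
    unfold auxG
    simp only [Finset.sum_product]
    refine Finset.sum_le_sum fun m hm => Finset.sum_le_sum fun s hs => Finset.sum_le_sum fun j hj => ?_
    simp only [hθ]
    push_cast
    exact min_le_min_right _ (aux_xle hx0 hM hS hJ hm hs hj)
  have h2 := aux_min_sum I θ H hH1 (by
    intro t ht
    simp only [hI, Finset.mem_product] at ht
    have a1 := (aux_dyad_mem hM ht.1).2.2
    have a2 := (aux_dyad_mem hS ht.2.1).2.2
    have a3 := (aux_dyad_mem hJ ht.2.2).2.2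
    apply aux_nint_irr hα
    have : 0 < t.1 ^ 3 * t.2.1 ^ 2 * t.2.2 := by positivity
    omega)
  refine h1.trans (h2.trans ?_)
  apply mul_le_mul_of_nonneg_left _ (by positivity)
  rw [Finset.range_eq_Ico, Finset.sum_eq_sum_Ico_succ_bot (by omega)]
  refine add_le_add ?_ ?_
  · refine (norm_sum_le _ _).trans ?_
    simp only [aux_e_norm, Finset.sum_const, nsmul_eq_mul, mul_one]
    rw [hI, Finset.card_product, Finset.card_product]
    push_cast
    rw [mul_assoc]
    have b1 := aux_dyad_card hM
    have b2 := aux_dyad_card hS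
    have b3 := aux_dyad_card hJ
    gcongr
  · unfold auxV
    rw [show Finset.Ico (0 + 1) (⌊H⌋₊ + 1) = Finset.Icc 1 ⌊H⌋₊ by ext; simp]
    apply Finset.sum_le_sum
    intro h _
    have heq : ∑ t ∈ I, e (h * θ t) = ∑ s ∈ dyad S, ∑ j ∈ dyad J, ∑ m ∈ dyad M,
        e (α * ((h * s ^ 2 * j : ℕ) : ℝ) * (m : ℝ) ^ 3) := by
      rw [hI, Finset.sum_product, Finset.sum_comm]
      rw [Finset.sum_product]
      refine Finset.sum_congr rfl fun s _ => Finset.sum_congr rfl fun j _ =>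
        Finset.sum_congr rfl fun m _ => ?_
      simp only [hθ]
      congr 1
      push_cast
      ring
    rw [heq]
    refine (norm_sum_le _ _).trans (Finset.sum_le_sum fun s _ => ?_)
    exact norm_sum_le _ _

lemma aux_log_bound (η : ℝ) (hη : 0 < η) {x : ℝ} (hx : 1 ≤ x) {H : ℝ} (hH : 1 ≤ H) (hHx : H ≤ 64 * x) :
    ((Nat.log 2 ⌊H⌋₊ + 1 : ℕ) : ℝ) ≤ (11 + 2 / η) * x ^ η := by
  have hfl : ⌊H⌋₊ ≠ 0 := by
    have : 1 ≤ ⌊H⌋₊ := Nat.le_floor (by simpa using hH)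
    omega
  set K := Nat.log 2 ⌊H⌋₊
  have h1 : ((2 : ℝ)) ^ K ≤ 64 * x := by
    have h := (Nat.le_floor_iff (by linarith)).1 (Nat.pow_log_le_self 2 hfl)
    push_cast at h
    linarith
  have h2 := Real.log_le_log (by positivity) h1
  rw [Real.log_pow, Real.log_mul (by norm_num) (by linarith)] at h2
  have h3 : Real.log 64 = 6 * Real.log 2 := by
    rw [show (64 : ℝ) = 2 ^ 6 by norm_num, Real.log_pow]; norm_num
  have h4 := Real.log_two_gt_d9
  have h5 := Real.log_two_lt_d9
  have h6 := Real.log_le_rpow_div (by linarith : 0 ≤ x) hη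
  have h7 : 1 ≤ x ^ η := Real.one_le_rpow hx hη.le
  have hK0 : (0 : ℝ) ≤ K := by positivity
  push_cast
  have h8 : (K : ℝ) / 2 ≤ 5 + x ^ η / η := by nlinarith
  have : (11 + 2 / η) * x ^ η = 11 * x ^ η + 2 * (x ^ η / η) := by ring
  rw [this]
  linarith

lemma aux_log_bound2 (η : ℝ) (hη : 0 < η) {x : ℝ} (hx : 1 ≤ x) {q : ℕ} (hq : 1 ≤ q) (hqx : (q : ℝ) ≤ x) :
    1 + Real.log (2 * q) ≤ (2 + 1 / η) * x ^ η := by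
  have hq0 : (0 : ℝ) < q := by exact_mod_cast hq
  rw [Real.log_mul (by norm_num) hq0.ne']
  have h5 := Real.log_two_lt_d9
  have h6 := Real.log_le_rpow_div (by linarith : 0 ≤ x) hη
  have h7 : 1 ≤ x ^ η := Real.one_le_rpow hx hη.le
  have h8 := Real.log_le_log hq0 hqx
  have : (2 + 1 / η) * x ^ η = 2 * x ^ η + (x ^ η / η) := by ring
  linarith

/-- Pure algebra: bound for the fourth power. -/
lemma aux_alg {x M S J q K Λ H : ℝ} (hM : 1 ≤ M) (hS : 1 ≤ S) (hJ : 1 ≤ J) (hx : M ^ 3 * S ^ 2 * J < x)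
    (hq : 1 ≤ q) (hK : 1 ≤ K) (hΛ : 1 ≤ Λ) (hH : H = 64 * x / (M ^ 3 * S ^ 2 * J)) :
    (H * S * J) ^ 3 * (8 * M * (2 * M ^ 2 * (H * S * J) +
      K * ((2 * (6 * H * S ^ 2 * J * M ^ 2) / q + 1) * (2 * M + 4 * q * Λ)))) ≤
    10 ^ 10 * (K * Λ) * (x ^ 4 / (M ^ 9 * S ^ 3) + x ^ 4 / (M ^ 8 * S ^ 3 * q)
      + x ^ 3 * q / (M ^ 8 * S ^ 3)) := by
  have hM2 : M ^ 2 ≤ x := by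
    have : M ^ 2 * 1 ≤ M ^ 2 * (M * S ^ 2 * J) := by
      gcongr
      have : 1 * 1 ^ 2 * 1 ≤ M * S ^ 2 * J := by gcongr
      linarith
    nlinarith
  have hx0 : 0 < x := lt_of_lt_of_le (by positivity) hM2
  have hP : H * S * J = 64 * x / (M ^ 3 * S) := by rw [hH]; field_simp
  have hN : 6 * H * S ^ 2 * J * M ^ 2 = 384 * x / M := by rw [hH]; field_simp; norm_num
  rw [hP, hN]
  have hKΛ : 1 ≤ K * Λ := by nlinarith
  have b1 : 8 * M * (2 * M ^ 2 * (64 * x / (M ^ 3 * S))) ≤ 1024 * x := by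
    have : 8 * M * (2 * M ^ 2 * (64 * x / (M ^ 3 * S))) = 1024 * x / S := by field_simp; norm_num
    rw [this]
    exact div_le_self (by positivity) hS
  have b2 : M * ((2 * (384 * x / M) / q + 1) * (2 * M + 4 * q * Λ)) ≤
      3076 * Λ * (x * M / q + x + M * q) := by
    have c1 : 2 * M + 4 * q * Λ ≤ 4 * Λ * (M + q) := by nlinarith
    calc M * ((2 * (384 * x / M) / q + 1) * (2 * M + 4 * q * Λ))
        ≤ M * ((2 * (384 * x / M) / q + 1) * (4 * Λ * (M + q))) := by gcongr
      _ = 4 * Λ * (768 * (x * M / q) + 768 * x + M ^ 2 + M * q) := by field_simp; ring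
      _ ≤ 4 * Λ * (769 * (x * M / q + x + M * q)) := by
          apply mul_le_mul_of_nonneg_left _ (by positivity)
          have : 0 ≤ x * M / q := by positivity
          have : 0 ≤ M * q := by positivity
          linarith
      _ = _ := by ring
  have b3 : 8 * M * (2 * M ^ 2 * (64 * x / (M ^ 3 * S)) +
      K * ((2 * (384 * x / M) / q + 1) * (2 * M + 4 * q * Λ))) ≤
      30000 * (K * Λ) * (x * M / q + x + M * q) := by
    have d0 : 0 ≤ x * M / q := by positivity
    have d1 : 0 ≤ M * q := by positivity
    have d2 : K * (M * ((2 * (384 * x / M) / q + 1) * (2 * M + 4 * q * Λ))) ≤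
      K * (3076 * Λ * (x * M / q + x + M * q)) := by gcongr
    have d3 : 1 * (x * M / q + x + M * q) ≤ (K * Λ) * (x * M / q + x + M * q) := by gcongr
    nlinarith
  calc _ ≤ (64 * x / (M ^ 3 * S)) ^ 3 * (30000 * (K * Λ) * (x * M / q + x + M * q)) := by gcongr
    _ = (64 ^ 3 * 30000) * (K * Λ) * (x ^ 4 / (M ^ 9 * S ^ 3) + x ^ 4 / (M ^ 8 * S ^ 3 * q)
      + x ^ 3 * q / (M ^ 8 * S ^ 3)) := by field_simp; ring
    _ ≤ _ := by gcongr; norm_num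

lemma aux_rpow4 (y : ℝ) (hy : 0 ≤ y) (k : ℕ) (r : ℝ) (h : r = (k : ℝ) / 4) : (y ^ r) ^ 4 = y ^ k := by
  rw [← Real.rpow_natCast, ← Real.rpow_mul hy, ← Real.rpow_natCast, h]
  congr 1; push_cast; ring


set_option maxHeartbeats 2000000

/-- Inequality (10) of Lemma 7. -/
theorem statement_5 (μ σ ζ : ℕ) (hμ : 2 ≤ μ) (hσ : 2 ≤ σ) (hζ : 2 ≤ ζ)
    (ε : ℝ) (hε : 0 < ε) :
    ∃ C : ℝ, ∀ (α : ℝ) (a : ℤ) (q : ℕ) (M S J x : ℝ),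
      Irrational α → 1 ≤ q → Int.gcd a q = 1 →
      |α - (a : ℝ) / q| < 1 / (q : ℝ) ^ 2 →
      0 < M → 0 < S → 0 < J → M ^ 3 * S ^ 2 * J < x →
      Gsum α x M S J μ σ ζ ≤
        C * x ^ ε * (M * S * J + x / (M ^ ((9 : ℝ) / 4) * S ^ ((3 : ℝ) / 4))
          + x / (M ^ 2 * S ^ ((3 : ℝ) / 4) * (q : ℝ) ^ ((1 : ℝ) / 4))
          + x ^ ((3 : ℝ) / 4) * (q : ℝ) ^ ((1 : ℝ) / 4) / (M ^ 2 * S ^ ((3 : ℝ) / 4))) := by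
  set η : ℝ := ε / 5 with hη
  have hη0 : 0 < η := by positivity
  obtain ⟨C1, hC1, ht1⟩ := aux_tauk_bound μ η hη0
  obtain ⟨C2, hC2, ht2⟩ := aux_tauk_bound σ η hη0
  obtain ⟨C3, hC3, ht3⟩ := aux_tauk_bound ζ η hη0
  obtain ⟨C5, hC5, hd⟩ := aux_div_pow 5 (2 * η) (by positivity)
  set Ct : ℝ := C1 + C2 + C3 with hCt
  have hCt1 : 1 ≤ Ct := by linarith
  set CK : ℝ := C5 * (384 : ℝ) ^ (2 * η) with hCK
  have hCK1 : 1 ≤ CK := by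
    have : 1 ≤ (384 : ℝ) ^ (2 * η) := Real.one_le_rpow (by norm_num) (by positivity)
    nlinarith
  set CΛ : ℝ := 2 + 1 / (2 * η) with hCΛ
  have hCΛ1 : 1 ≤ CΛ := by
    have : 0 < 1 / (2 * η) := by positivity
    linarith
  set CV : ℝ := 10 ^ 10 * (CK * CΛ) with hCV
  have hCV1 : 1 ≤ CV := by
    have : 1 ≤ CK * CΛ := by nlinarith
    linarith
  set CL : ℝ := 11 + 2 / η with hCL
  have hCL1 : 11 ≤ CL := by
    have : 0 < 2 / η := by positivity
    linarith
  clear_value CL CV CΛ CK Ct η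
  refine ⟨Ct ^ 3 * (32 * CL * CV), ?_⟩
  intro α a q M S J x hα hq hgcd hαq hM hS hJ hx
  have hq1 : (1 : ℝ) ≤ q := by exact_mod_cast hq
  have hq0 : (0 : ℝ) < q := by linarith
  have hx0 : 0 < x := lt_trans (by positivity) hx
  set A : ℝ := x / (M ^ ((9 : ℝ) / 4) * S ^ ((3 : ℝ) / 4)) with hA
  set B : ℝ := x / (M ^ 2 * S ^ ((3 : ℝ) / 4) * (q : ℝ) ^ ((1 : ℝ) / 4)) with hB
  set D : ℝ := x ^ ((3 : ℝ) / 4) * (q : ℝ) ^ ((1 : ℝ) / 4) / (M ^ 2 * S ^ ((3 : ℝ) / 4)) with hD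
  clear_value A B D
  have hA0 : 0 < A := by rw [hA]; positivity
  have hB0 : 0 < B := by rw [hB]; positivity
  have hD0 : 0 < D := by rw [hD]; positivity
  have hCpos : 0 < Ct ^ 3 * (32 * CL * CV) := by positivity
  have hMSJ : 0 < M * S * J := by positivity
  by_cases hne : (dyad M).Nonempty ∧ (dyad S).Nonempty ∧ (dyad J).Nonempty
  swap
  · have : Gsum α x M S J μ σ ζ = 0 := by
      unfold Gsum
      simp only [not_and_or, Finset.not_nonempty_iff_eq_empty] at hne
      rcases hne with h | h | h <;> simp [h]
    rw [this]
    positivity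
  have hone : ∀ X : ℝ, 0 < X → (dyad X).Nonempty → 1 ≤ X := by
    rintro X hX ⟨n, hn⟩
    have h := aux_dyad_mem hX hn
    have : (1 : ℝ) ≤ n := by exact_mod_cast h.2.2
    linarith
  have hM1 := hone M hM hne.1
  have hS1 := hone S hS hne.2.1
  have hJ1 := hone J hJ hne.2.2
  have hMx : M ≤ x := by
    have : M * 1 ≤ M * (M ^ 2 * S ^ 2 * J) := by
      gcongr
      have : 1 ^ 2 * 1 ^ 2 * 1 ≤ M ^ 2 * S ^ 2 * J := by gcongr
      linarith
    linarith only [this, hx]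
  have hSx : S ≤ x := by
    have : S * 1 ≤ S * (M ^ 3 * S * J) := by
      gcongr
      have : 1 ^ 3 * 1 * 1 ≤ M ^ 3 * S * J := by gcongr
      linarith
    linarith only [this, hx]
  have hJx : J ≤ x := by
    have : J * 1 ≤ J * (M ^ 3 * S ^ 2) := by
      gcongr
      have : 1 ^ 3 * 1 ^ 2 ≤ M ^ 3 * S ^ 2 := by gcongr
      linarith
    linarith only [this, hx]
  have hx1 : 1 ≤ x := hM1.trans hMx
  have hxη : 1 ≤ x ^ η := Real.one_le_rpow hx1 hη0.le
  have htau : ∀ (k : ℕ) (c X : ℝ), 0 < X → X ≤ x → 1 ≤ c → c ≤ Ct →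
      (∀ n : ℕ, 1 ≤ n → (tauk k n : ℝ) ≤ c * (n : ℝ) ^ η) →
      ∀ n ∈ dyad X, (tauk k n : ℝ) ≤ Ct * x ^ η := by
    intro k c X hX hXx hc1 hc h n hn
    have h' := aux_dyad_mem hX hn
    have hnx : (n : ℝ) ≤ x := h'.2.1.le.trans hXx
    calc (tauk k n : ℝ) ≤ c * (n : ℝ) ^ η := h n h'.2.2
      _ ≤ Ct * x ^ η := by gcongr
  have hG := aux_G_tau α x M S J (Ct * x ^ η) μ σ ζ (by positivity) hx0.le
    (htau μ C1 M hM hMx hC1 (by linarith) ht1) (htau σ C2 S hS hSx hC2 (by linarith) ht2)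
    (htau ζ C3 J hJ hJx hC3 (by linarith) ht3)
  have hmain : auxG α x M S J ≤ 32 * CL * CV * (x ^ η) ^ 2 * (M * S * J + A + B + D) := by
    have hbig : 64 ≤ 32 * CL * CV * (x ^ η) ^ 2 := by
      have h1 : 1 ≤ (x ^ η) ^ 2 := one_le_pow₀ hxη
      have h2 : 32 * 11 * 1 * 1 ≤ 32 * CL * CV * (x ^ η) ^ 2 := by gcongr
      linarith
    rcases le_or_gt (q : ℝ) x with hqx | hqx
    · set H := 64 * x / (M ^ 3 * S ^ 2 * J) with hH
      clear_value H
      have hden : 0 < M ^ 3 * S ^ 2 * J := by positivity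
      have hH1 : 1 ≤ H := by
        rw [hH, le_div_iff₀ hden]; linarith
      have hHx : H ≤ 64 * x := by
        rw [hH]
        apply div_le_self (by positivity)
        have : 1 ^ 3 * 1 ^ 2 * 1 ≤ M ^ 3 * S ^ 2 * J := by gcongr
        linarith
      have hGV := aux_G_V hα hM hS hJ hx
      rw [← hH] at hGV
      have hlog := aux_log_bound η hη0 hx1 hH1 hHx
      rw [← hCL] at hlog
      have hlog2 := aux_log_bound2 (2 * η) (by positivity) hx1 hq hqx
      rw [← hCΛ] at hlog2
      have hV0 : 0 ≤ auxV α M S J H := Finset.sum_nonneg fun _ _ => Finset.sum_nonneg fun _ _ =>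
        Finset.sum_nonneg fun _ _ => auxT_nonneg _ _ _
      have hNx : 6 * H * S ^ 2 * J * M ^ 2 ≤ 384 * x := by
        have : 6 * H * S ^ 2 * J * M ^ 2 = 384 * x / M := by rw [hH]; field_simp; norm_num
        rw [this]
        exact div_le_self (by positivity) hM1
      have hx2η : 1 ≤ x ^ (2 * η) := Real.one_le_rpow hx1 (by positivity)
      have hV4 := aux_V4 hα a q hq hgcd hαq hM hS hJ hH1 (CK * x ^ (2 * η)) (by
        intro n hn
        rw [Finset.mem_Icc] at hn
        have hn2 : (n : ℝ) ≤ 384 * x :=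
          ((Nat.le_floor_iff (by positivity)).1 hn.2).trans hNx
        calc _ ≤ C5 * (n : ℝ) ^ (2 * η) := hd n hn.1
          _ ≤ C5 * (384 * x) ^ (2 * η) := by gcongr
          _ = _ := by rw [Real.mul_rpow (by norm_num) hx0.le, hCK]; ring) (by positivity)
      have hΛ1 : 1 ≤ 1 + Real.log (2 * q) := by
        have := Real.log_nonneg (by linarith : (1 : ℝ) ≤ 2 * q)
        linarith
      have halg := aux_alg (K := CK * x ^ (2 * η)) (Λ := 1 + Real.log (2 * q)) hM1 hS1 hJ1 hx hq1
        (by nlinarith) hΛ1 hH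
      have e1 : x ^ 4 / (M ^ 9 * S ^ 3) = A ^ 4 := by
        rw [hA, div_pow, mul_pow, aux_rpow4 M hM.le 9 _ (by norm_num), aux_rpow4 S hS.le 3 _ (by norm_num)]
      have e2 : x ^ 4 / (M ^ 8 * S ^ 3 * q) = B ^ 4 := by
        rw [hB, div_pow, mul_pow, mul_pow, aux_rpow4 S hS.le 3 _ (by norm_num),
          aux_rpow4 q hq0.le 1 _ (by norm_num), ← pow_mul, pow_one]
      have e3 : x ^ 3 * q / (M ^ 8 * S ^ 3) = D ^ 4 := by
        rw [hD, div_pow, mul_pow, mul_pow, aux_rpow4 S hS.le 3 _ (by norm_num),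
          aux_rpow4 x hx0.le 3 _ (by norm_num),
          aux_rpow4 q hq0.le 1 _ (by norm_num), ← pow_mul, pow_one]
      rw [e1, e2, e3] at halg
      have hsum4 : A ^ 4 + B ^ 4 + D ^ 4 ≤ (A + B + D) ^ 4 := by
        have h1 : A ^ 4 + B ^ 4 ≤ (A + B) ^ 4 := pow_add_pow_le hA0.le hB0.le (by norm_num)
        have h2 : (A + B) ^ 4 + D ^ 4 ≤ (A + B + D) ^ 4 :=
          pow_add_pow_le (by positivity) hD0.le (by norm_num)
        linarith
      have hVfin : auxV α M S J H ≤ CV * x ^ η * (A + B + D) := by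
        have : auxV α M S J H ^ 4 ≤ (CV * x ^ η * (A + B + D)) ^ 4 := by
          have hxx : x ^ (2 * η) * x ^ (2 * η) = (x ^ η) ^ 4 := by
            rw [← Real.rpow_add hx0, ← Real.rpow_natCast, ← Real.rpow_mul hx0.le]
            congr 1; push_cast; ring
          calc auxV α M S J H ^ 4 ≤ _ := hV4.trans halg
            _ ≤ 10 ^ 10 * ((CK * x ^ (2 * η)) * (CΛ * x ^ (2 * η))) * (A + B + D) ^ 4 := by
                gcongr
            _ = CV * (x ^ η) ^ 4 * (A + B + D) ^ 4 := by
                rw [← hxx, hCV]; ring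
            _ ≤ CV ^ 4 * (x ^ η) ^ 4 * (A + B + D) ^ 4 := by
                gcongr
                exact le_self_pow₀ hCV1 (by norm_num)
            _ = _ := by ring
        exact (pow_le_pow_iff_left₀ hV0 (by positivity) (by norm_num)).1 this
      calc auxG α x M S J ≤ _ := hGV
        _ ≤ 32 * (CL * x ^ η) * (M * S * J + CV * x ^ η * (A + B + D)) := by gcongr
        _ ≤ 32 * (CL * x ^ η) * (CV * x ^ η * (M * S * J) + CV * x ^ η * (A + B + D)) := by
            have h1 : 1 ≤ CV * x ^ η := by nlinarith
            have h2 : M * S * J ≤ CV * x ^ η * (M * S * J) :=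
              le_mul_of_one_le_left (by positivity) h1
            apply mul_le_mul_of_nonneg_left _ (by positivity)
            linarith only [h2]
        _ = _ := by ring
    · have htr := aux_G_triv (α := α) hx0 hM hS hJ
      have hDge : x / (M ^ 2 * S) ≤ D := by
        rw [hD]
        have h1 : x ≤ x ^ ((3 : ℝ) / 4) * (q : ℝ) ^ ((1 : ℝ) / 4) := by
          calc x = x ^ ((3 : ℝ) / 4) * x ^ ((1 : ℝ) / 4) := by
                rw [← Real.rpow_add hx0]; norm_num
            _ ≤ _ := by gcongr
        have h2 : S ^ ((3 : ℝ) / 4) ≤ S := by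
          calc S ^ ((3 : ℝ) / 4) ≤ S ^ (1 : ℝ) := Real.rpow_le_rpow_of_exponent_le hS1 (by norm_num)
            _ = S := Real.rpow_one S
        gcongr
      calc auxG α x M S J ≤ 64 * (x / (M ^ 2 * S)) := by rw [← mul_div_assoc]; exact htr
        _ ≤ 64 * (M * S * J + A + B + D) := by linarith
        _ ≤ _ := by gcongr
  calc Gsum α x M S J μ σ ζ ≤ _ := hG
    _ ≤ (Ct * x ^ η) ^ 3 * (32 * CL * CV * (x ^ η) ^ 2 * (M * S * J + A + B + D)) := by gcongr
    _ = Ct ^ 3 * (32 * CL * CV) * (x ^ η) ^ 5 * (M * S * J + A + B + D) := by ring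
    _ = _ := by
        have : (x ^ η) ^ 5 = x ^ ε := by
          rw [← Real.rpow_natCast, ← Real.rpow_mul hx0.le]
          congr 1; rw [hη]; push_cast; ring
        rw [this]
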